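/- Let s ∈ ℝ. There exists a constant c₁ > 0, depending only on s, such that for every nonzero Schwartz function u on ℝ there is a constant C_u < ∞ with the following property: for every A > 0, x₀ ∈ ℝ, M > 1, and τ > 0 with τ M ≥ C_u, the function v(x) = A e^{iMx} u((x − x₀)/τ) satisfies ‖v‖_{H^s} ≥ c₁ A τ^{1/2} M^s ‖u‖_{L²(ℝ)}. -/

import Mathlib

open MeasureTheory Complex
open scoped ENNReal

/-- The Fourier transform `û(ξ) = ∫ e^{-ixξ} u(x) dx`. -/
noncomputable def fourierInt (u : ℝ → ℂ) (ξ : ℝ) : ℂ :=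
  ∫ x : ℝ, Complex.exp (-(Complex.I * x * ξ)) * u x

/-- The Sobolev norm `‖u‖_{H^s} = ‖⟨ξ⟩^s û(ξ)‖_{L²_ξ}`, `⟨ξ⟩ = (1+ξ²)^{1/2}`. -/
noncomputable def HsNorm (s : ℝ) (u : ℝ → ℂ) : ℝ≥0∞ :=
  eLpNorm (fun ξ : ℝ => (((1 + ξ^2) ^ (s/2) : ℝ) : ℂ) * fourierInt u ξ) 2 volume

open Filter FourierTransform
open scoped Topology

/-- The Fourier transform of a modulated, rescaled and translated profile. -/
lemma norm_fourierInt_wavePacket (u : ℝ → ℂ) {A τ : ℝ} (hA : 0 < A) (hτ : 0 < τ) (x₀ M ξ : ℝ) :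
    ‖fourierInt (fun x => (A : ℂ) * Complex.exp (Complex.I * M * x) * u ((x - x₀) / τ)) ξ‖ =
      A * τ * ‖𝓕 u (τ / (2 * Real.pi) * (ξ - M))‖ := by
  set g : ℝ → ℂ := fun y => (A * Complex.exp (-(Complex.I * x₀ * (ξ - M)))) *
    (Complex.exp (↑(-2 * Real.pi * y * (τ / (2 * Real.pi) * (ξ - M))) * Complex.I) • u y)
  have hpi := Real.pi_ne_zero
  have h1 : fourierInt (fun x => (A : ℂ) * Complex.exp (Complex.I * M * x) * u ((x - x₀) / τ)) ξ =
      ∫ x : ℝ, g ((x - x₀) / τ) := by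
    unfold fourierInt
    congr 1
    funext x
    simp only [g, smul_eq_mul]
    have h2 : -2 * Real.pi * ((x - x₀) / τ) * (τ / (2 * Real.pi) * (ξ - M)) =
        -((x - x₀) * (ξ - M)) := by
      field_simp
    have h3 : Complex.exp (-(Complex.I * x * ξ)) * Complex.exp (Complex.I * M * x) =
        Complex.exp (-(Complex.I * x₀ * (ξ - M))) *
          Complex.exp (((-((x - x₀) * (ξ - M)) : ℝ) : ℂ) * Complex.I) := by
      rw [← Complex.exp_add, ← Complex.exp_add]
      congr 1
      push_cast
      ring
    rw [h2]
    linear_combination (A * u ((x - x₀) / τ)) * h3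
  rw [h1, integral_sub_right_eq_self (fun x => g (x / τ)), Measure.integral_comp_div,
    integral_const_mul, ← Real.fourier_real_eq_integral_exp_smul]
  have h4 : ‖Complex.exp (-(Complex.I * x₀ * (ξ - M)))‖ = 1 := by
    rw [Complex.norm_exp]
    simp
  rw [norm_smul, norm_mul, norm_mul, h4, Complex.norm_real, Real.norm_of_nonneg hA.le,
    Real.norm_of_nonneg (abs_nonneg τ), abs_of_pos hτ]
  ring

lemma eLpNorm_two_comp_mul_sub {g : ℝ → ℂ} (hg : AEStronglyMeasurable g volume)
    {a : ℝ} (ha : 0 < a) (M : ℝ) :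
    eLpNorm (fun ξ => g (a * (ξ - M))) 2 volume =
      ENNReal.ofReal (a⁻¹ ^ ((1 : ℝ) / 2)) * eLpNorm g 2 volume := by
  have hmap : Measure.map (fun x : ℝ => a * x) volume = ENNReal.ofReal a⁻¹ • volume := by
    rw [Real.map_volume_mul_left ha.ne', abs_of_pos (inv_pos.mpr ha)]
  have hg' : AEStronglyMeasurable g (Measure.map (fun x : ℝ => a * x) volume) := by
    rw [hmap]
    exact hg.smul_measure _
  have h1 : eLpNorm (fun ξ => g (a * ξ)) 2 volume =
      ENNReal.ofReal (a⁻¹ ^ ((1 : ℝ) / 2)) * eLpNorm g 2 volume := by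
    have h2 := eLpNorm_map_measure (p := 2) hg' (by fun_prop)
    rw [hmap, eLpNorm_smul_measure_of_ne_zero (by simpa using ha)] at h2
    rw [← ENNReal.ofReal_rpow_of_pos (inv_pos.mpr ha)]
    simpa [Function.comp_def] using h2.symm
  have h3 : AEStronglyMeasurable (fun ξ => g (a * ξ)) volume :=
    hg'.comp_measurable (measurable_const_mul a)
  rw [← h1]
  exact eLpNorm_comp_measurePreserving h3 (measurePreserving_sub_right volume M)

lemma eLpNorm_fourier_schwartz (u : SchwartzMap ℝ ℂ) :
    eLpNorm (fun x => 𝓕 (u : ℝ → ℂ) x) 2 volume = eLpNorm (fun x => u x) 2 volume := by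
  have h := SchwartzMap.norm_fourier_toL2_eq u
  rw [SchwartzMap.norm_toLp, SchwartzMap.norm_toLp,
    ENNReal.toReal_eq_toReal_iff' ((𝓕 u).memLp 2 volume).2.ne (u.memLp 2 volume).2.ne] at h
  exact h

lemma exists_closedBall_eLpNorm_le {g : ℝ → ℂ} (hg : MemLp g 2 volume) {k : ℝ} (hk : 1 < k) :
    ∃ R : ℝ, 0 < R ∧ eLpNorm g 2 volume ≤
      ENNReal.ofReal k * eLpNorm ((Metric.closedBall 0 R).indicator g) 2 volume := by
  rcases eq_or_ne (eLpNorm g 2 volume) 0 with h0 | h0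
  · exact ⟨1, one_pos, by simp [h0]⟩
  have hcover : AECover (volume : Measure ℝ) atTop fun R : ℝ => Metric.closedBall (0 : ℝ) R :=
    aecover_closedBall tendsto_id
  have ht : Tendsto (fun R : ℝ => eLpNorm ((Metric.closedBall 0 R).indicator g) 2 volume) atTop
      (𝓝 (eLpNorm g 2 volume)) := by
    simp_rw [eLpNorm_indicator_eq_eLpNorm_restrict Metric.isClosed_closedBall.measurableSet,
      eLpNorm_eq_lintegral_rpow_enorm_toReal two_ne_zero ENNReal.ofNat_ne_top]
    exact (hcover.lintegral_tendsto_of_countably_generated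
      (hg.1.enorm.pow_const _)).ennrpow_const _
  have ht' := ENNReal.Tendsto.const_mul (a := ENNReal.ofReal k) ht (Or.inr ENNReal.ofReal_ne_top)
  have hlt : eLpNorm g 2 volume < ENNReal.ofReal k * eLpNorm g 2 volume := by
    conv_lhs => rw [← one_mul (eLpNorm g 2 volume)]
    exact ENNReal.mul_lt_mul_left h0 hg.2.ne (by simpa using hk)
  obtain ⟨R, hR, hpos⟩ := ((ht'.eventually_const_lt hlt).and (eventually_gt_atTop 0)).exists
  exact ⟨R, hpos, hR.le⟩

lemma rpow_le_japaneseBracket (s : ℝ) {M ξ : ℝ} (hM : 1 < M) (hξ : |ξ - M| ≤ M / 2) :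
    2 ^ (-|s|) * M ^ s ≤ (1 + ξ ^ 2) ^ (s / 2) := by
  have hM0 : 0 < M := by linarith
  obtain ⟨h1, h2⟩ := abs_le.mp hξ
  have hJ : (1 + ξ ^ 2) ^ (s / 2) = (Real.sqrt (1 + ξ ^ 2)) ^ s := by
    rw [Real.sqrt_eq_rpow, ← Real.rpow_mul (by positivity)]
    ring_nf
  have hlow : M / 2 ≤ Real.sqrt (1 + ξ ^ 2) := Real.le_sqrt_of_sq_le (by nlinarith)
  have hupp : Real.sqrt (1 + ξ ^ 2) ≤ 2 * M :=
    Real.sqrt_le_iff.mpr ⟨by positivity, by nlinarith⟩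
  rw [hJ]
  rcases le_total 0 s with hs | hs
  · rw [abs_of_nonneg hs, Real.rpow_neg zero_le_two, inv_mul_eq_div,
      ← Real.div_rpow hM0.le zero_le_two]
    exact Real.rpow_le_rpow (by positivity) hlow hs
  · rw [abs_of_nonpos hs, neg_neg, ← Real.mul_rpow zero_le_two hM0.le]
    exact Real.rpow_le_rpow_of_nonpos (by positivity) hupp hs

/-- `H^s` lower bound for high-frequency modulations: for each nonzero Schwartz `u`
there is `C_u` such that if `τM ≥ C_u` then `v(x) = A e^{iMx} u((x-x₀)/τ)` satisfies
`‖v‖_{H^s} ≥ c₁ A τ^{1/2} M^s ‖u‖_{L²}`. -/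
theorem stmt_18 (s : ℝ) :
    ∃ c₁ > (0:ℝ), ∀ u : SchwartzMap ℝ ℂ, u ≠ 0 →
      ∃ Cu : ℝ, ∀ A x₀ M τ : ℝ,
        0 < A → 1 < M → 0 < τ → Cu ≤ τ * M →
        ENNReal.ofReal (c₁ * A * τ ^ ((1:ℝ)/2) * M ^ s) *
            eLpNorm (fun x : ℝ => u x) 2 volume ≤
          HsNorm s (fun x => (A : ℂ) * Complex.exp (Complex.I * M * x) * u ((x - x₀) / τ)) := by
  refine ⟨2 ^ (-|s|), by positivity, fun u _ => ?_⟩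
  set G : ℝ → ℂ := fun x => 𝓕 (u : ℝ → ℂ) x with hG
  have hGm : MemLp G 2 volume := (𝓕 u).memLp 2 volume
  have hpi := Real.pi_pos
  have hk : 1 < (2 * Real.pi) ^ ((1 : ℝ) / 2) :=
    Real.one_lt_rpow (by linarith [Real.pi_gt_three]) (by norm_num)
  obtain ⟨R, hR, hGR⟩ := exists_closedBall_eLpNorm_le hGm hk
  refine ⟨4 * Real.pi * R, fun A x₀ M τ hA hM hτ hCu => ?_⟩
  have hM0 : 0 < M := by linarith
  set a := τ / (2 * Real.pi) with ha
  have ha0 : 0 < a := by positivity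
  set B := (Metric.closedBall (0 : ℝ) R).indicator G with hB
  have hBm : AEStronglyMeasurable B volume :=
    hGm.1.indicator Metric.isClosed_closedBall.measurableSet
  set c : ℝ := 2 ^ (-|s|) * M ^ s * (A * τ) with hc
  have hc0 : 0 ≤ c := by positivity
  have hpoint : ∀ ξ : ℝ, ‖(c : ℂ) • B (a * (ξ - M))‖ ≤
      ‖(((1 + ξ^2) ^ (s/2) : ℝ) : ℂ) * fourierInt
        (fun x => (A : ℂ) * Complex.exp (Complex.I * M * x) * u ((x - x₀) / τ)) ξ‖ := by
    intro ξ
    by_cases hξ : a * (ξ - M) ∈ Metric.closedBall (0 : ℝ) R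
    · have hBξ : B (a * (ξ - M)) = G (a * (ξ - M)) := Set.indicator_of_mem hξ _
      rw [hBξ, norm_smul, norm_mul, norm_fourierInt_wavePacket u hA hτ, Complex.norm_real,
        Complex.norm_real, Real.norm_of_nonneg hc0,
        Real.norm_of_nonneg (by positivity : (0 : ℝ) ≤ (1 + ξ ^ 2) ^ (s / 2))]
      have hξM : |ξ - M| ≤ M / 2 := by
        rw [mem_closedBall_zero_iff, Real.norm_eq_abs, abs_mul, abs_of_pos ha0] at hξ
        have haM : R ≤ a * (M / 2) := by
          rw [ha, div_mul_eq_mul_div, le_div_iff₀ (by positivity)]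
          linarith
        exact le_of_mul_le_mul_left (hξ.trans haM) ha0
      calc c * ‖G (a * (ξ - M))‖
          = (2 ^ (-|s|) * M ^ s) * (A * τ * ‖G (a * (ξ - M))‖) := by rw [hc]; ring
        _ ≤ _ := mul_le_mul_of_nonneg_right (rpow_le_japaneseBracket s hM hξM) (by positivity)
    · have hBξ : B (a * (ξ - M)) = 0 := Set.indicator_of_notMem hξ _
      rw [hBξ, smul_zero, norm_zero]
      positivity
  have hconst : c * a⁻¹ ^ ((1 : ℝ) / 2) =
      2 ^ (-|s|) * A * τ ^ ((1 : ℝ) / 2) * M ^ s * (2 * Real.pi) ^ ((1 : ℝ) / 2) := by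
    have hτ2 : τ = τ ^ ((1 : ℝ) / 2) * τ ^ ((1 : ℝ) / 2) := by
      rw [← Real.rpow_add hτ]
      norm_num
    have hne : τ ^ ((1 : ℝ) / 2) ≠ 0 := by positivity
    rw [ha, inv_div, Real.div_rpow (by positivity) hτ.le, hc, ← mul_div_assoc, div_eq_iff hne]
    linear_combination (2 ^ (-|s|) * M ^ s * A * (2 * Real.pi) ^ ((1 : ℝ) / 2)) * hτ2
  calc ENNReal.ofReal (2 ^ (-|s|) * A * τ ^ ((1 : ℝ) / 2) * M ^ s) *
        eLpNorm (fun x : ℝ => u x) 2 volume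
      ≤ ENNReal.ofReal (2 ^ (-|s|) * A * τ ^ ((1 : ℝ) / 2) * M ^ s) *
        (ENNReal.ofReal ((2 * Real.pi) ^ ((1 : ℝ) / 2)) * eLpNorm B 2 volume) := by
        rw [← eLpNorm_fourier_schwartz u]
        gcongr
    _ = ENNReal.ofReal c * (ENNReal.ofReal (a⁻¹ ^ ((1 : ℝ) / 2)) * eLpNorm B 2 volume) := by
        rw [← mul_assoc, ← mul_assoc, ← ENNReal.ofReal_mul (by positivity),
          ← ENNReal.ofReal_mul hc0, hconst]
    _ = eLpNorm (fun ξ => (c : ℂ) • B (a * (ξ - M))) 2 volume := by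
        rw [← eLpNorm_two_comp_mul_sub hBm ha0 M]
        refine Eq.trans ?_ (eLpNorm_const_smul (c : ℂ) _ 2 volume).symm
        rw [← ofReal_norm, Complex.norm_real, Real.norm_of_nonneg hc0]
    _ ≤ _ := eLpNorm_mono hpoint
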